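/- In a differential category, for every object A the following four equalities hold: K_A !(0) = !(0) = !(0) K_A, J_A !(0) = !(0) = !(0) J_A, K_A d°_A = d°_A (J_A ⊗ 1_A), and d_A K_A = (J_A ⊗ 1_A) d_A. -/

import Mathlib

universe u v

/-- A symmetric strict monoidal category (data and the coherence axioms that
do not require transport along object equalities). Composition `comp f g`
is in diagrammatic order: first `f`, then `g`. -/
structure SMCData where
  Obj : Type u
  Hom : Obj → Obj → Type v
  id : ∀ A : Obj, Hom A A
  comp : ∀ {A B C : Obj}, Hom A B → Hom B C → Hom A C
  id_comp : ∀ {A B : Obj} (f : Hom A B), comp (id A) f = f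
  comp_id : ∀ {A B : Obj} (f : Hom A B), comp f (id B) = f
  comp_assoc : ∀ {A B C D : Obj} (f : Hom A B) (g : Hom B C) (h : Hom C D),
    comp (comp f g) h = comp f (comp g h)
  ten : Obj → Obj → Obj
  unit : Obj
  tHom : ∀ {A B C D : Obj}, Hom A C → Hom B D → Hom (ten A B) (ten C D)
  tHom_id : ∀ (A B : Obj), tHom (id A) (id B) = id (ten A B)
  tHom_comp : ∀ {A₁ A₂ A₃ B₁ B₂ B₃ : Obj} (f : Hom A₁ A₂) (g : Hom A₂ A₃)
    (f' : Hom B₁ B₂) (g' : Hom B₂ B₃),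
    tHom (comp f g) (comp f' g') = comp (tHom f f') (tHom g g')
  tenAssoc : ∀ (A B C : Obj), ten (ten A B) C = ten A (ten B C)
  unit_ten : ∀ (A : Obj), ten unit A = A
  ten_unit : ∀ (A : Obj), ten A unit = A
  sw : ∀ (A B : Obj), Hom (ten A B) (ten B A)
  sw_natural : ∀ {A B C D : Obj} (f : Hom A C) (g : Hom B D),
    comp (tHom f g) (sw C D) = comp (sw A B) (tHom g f)
  sw_sw : ∀ (A B : Obj), comp (sw A B) (sw B A) = id (ten A B)

/-- The identity morphism transported along an equality of objects. In a
strict monoidal category the structural isomorphisms are identities, so these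
are used to express the strictness identifications. -/
def SMCData.cHom (C : SMCData) {A B : C.Obj} (h : A = B) : C.Hom A B := by
  cases h; exact C.id A
/-- A differential category: an additive symmetric strict monoidal category with a coalgebra modality and a deriving transformation. -/
structure DiffCat extends SMCData where
  -- strictness coherence: associativity and unit identifications are
  -- (transported) identities compatible with the tensor of morphisms,
  -- and the symmetry satisfies the (strict) hexagon identity
  assoc_natural : ∀ {A₁ A₂ B₁ B₂ C₁ C₂ : Obj} (f : Hom A₁ A₂) (g : Hom B₁ B₂) (h : Hom C₁ C₂),
    comp (tHom (tHom f g) h) (toSMCData.cHom (tenAssoc A₂ B₂ C₂)) =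
      comp (toSMCData.cHom (tenAssoc A₁ B₁ C₁)) (tHom f (tHom g h))
  unit_ten_natural : ∀ {A B : Obj} (f : Hom A B),
    comp (tHom (id unit) f) (toSMCData.cHom (unit_ten B)) =
      comp (toSMCData.cHom (unit_ten A)) f
  ten_unit_natural : ∀ {A B : Obj} (f : Hom A B),
    comp (tHom f (id unit)) (toSMCData.cHom (ten_unit B)) =
      comp (toSMCData.cHom (ten_unit A)) f
  hexagon : ∀ (A B C : Obj),
    comp (toSMCData.cHom (tenAssoc A B C))
      (comp (tHom (id A) (sw B C))
        (comp (toSMCData.cHom (tenAssoc A C B).symm)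
          (comp (tHom (sw A C) (id B)) (toSMCData.cHom (tenAssoc C A B))))) =
      sw (ten A B) C
  -- additive enrichment: hom-sets are commutative monoids and composition
  -- and tensor preserve the additive structure
  add : ∀ {A B : Obj}, Hom A B → Hom A B → Hom A B
  zero : ∀ {A B : Obj}, Hom A B
  add_assoc : ∀ {A B : Obj} (f g h : Hom A B), add (add f g) h = add f (add g h)
  add_comm : ∀ {A B : Obj} (f g : Hom A B), add f g = add g f
  add_zero : ∀ {A B : Obj} (f : Hom A B), add f zero = f
  comp_add : ∀ {A B C : Obj} (f : Hom A B) (g h : Hom B C),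
    comp f (add g h) = add (comp f g) (comp f h)
  add_comp : ∀ {A B C : Obj} (f g : Hom A B) (h : Hom B C),
    comp (add f g) h = add (comp f h) (comp g h)
  comp_zero : ∀ {A B C : Obj} (f : Hom A B), comp f (zero : Hom B C) = zero
  zero_comp : ∀ {A B C : Obj} (f : Hom B C), comp (zero : Hom A B) f = zero
  tHom_add_left : ∀ {A B C D : Obj} (f g : Hom A C) (h : Hom B D),
    tHom (add f g) h = add (tHom f h) (tHom g h)
  tHom_add_right : ∀ {A B C D : Obj} (f : Hom A C) (g h : Hom B D),
    tHom f (add g h) = add (tHom f g) (tHom f h)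
  tHom_zero_left : ∀ {A B C D : Obj} (h : Hom B D),
    tHom (zero : Hom A C) h = zero
  tHom_zero_right : ∀ {A B C D : Obj} (f : Hom A C),
    tHom f (zero : Hom B D) = zero
  -- a coalgebra modality: a comonad (bang, rho, eps) with natural
  -- cocommutative comonoid structure (cmul, cunit) on each bang A,
  -- for which each rho A is a comonoid morphism
  bang : Obj → Obj
  bangMap : ∀ {A B : Obj}, Hom A B → Hom (bang A) (bang B)
  bangMap_id : ∀ (A : Obj), bangMap (id A) = id (bang A)
  bangMap_comp : ∀ {A B C : Obj} (f : Hom A B) (g : Hom B C),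
    bangMap (comp f g) = comp (bangMap f) (bangMap g)
  rho : ∀ (A : Obj), Hom (bang A) (bang (bang A))
  eps : ∀ (A : Obj), Hom (bang A) A
  cmul : ∀ (A : Obj), Hom (bang A) (ten (bang A) (bang A))
  cunit : ∀ (A : Obj), Hom (bang A) unit
  rho_natural : ∀ {A B : Obj} (f : Hom A B),
    comp (bangMap f) (rho B) = comp (rho A) (bangMap (bangMap f))
  eps_natural : ∀ {A B : Obj} (f : Hom A B),
    comp (bangMap f) (eps B) = comp (eps A) f
  cmul_natural : ∀ {A B : Obj} (f : Hom A B),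
    comp (bangMap f) (cmul B) = comp (cmul A) (tHom (bangMap f) (bangMap f))
  cunit_natural : ∀ {A B : Obj} (f : Hom A B),
    comp (bangMap f) (cunit B) = cunit A
  rho_eps : ∀ (A : Obj), comp (rho A) (eps (bang A)) = id (bang A)
  rho_bangMap_eps : ∀ (A : Obj), comp (rho A) (bangMap (eps A)) = id (bang A)
  rho_rho : ∀ (A : Obj), comp (rho A) (rho (bang A)) = comp (rho A) (bangMap (rho A))
  cmul_coassoc : ∀ (A : Obj),
    comp (cmul A) (comp (tHom (cmul A) (id (bang A)))
      (toSMCData.cHom (tenAssoc (bang A) (bang A) (bang A)))) =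
    comp (cmul A) (tHom (id (bang A)) (cmul A))
  cmul_counit_left : ∀ (A : Obj),
    comp (cmul A) (comp (tHom (cunit A) (id (bang A)))
      (toSMCData.cHom (unit_ten (bang A)))) = id (bang A)
  cmul_counit_right : ∀ (A : Obj),
    comp (cmul A) (comp (tHom (id (bang A)) (cunit A))
      (toSMCData.cHom (ten_unit (bang A)))) = id (bang A)
  cmul_cocomm : ∀ (A : Obj), comp (cmul A) (sw (bang A) (bang A)) = cmul A
  rho_cmul : ∀ (A : Obj),
    comp (rho A) (cmul (bang A)) = comp (cmul A) (tHom (rho A) (rho A))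
  rho_cunit : ∀ (A : Obj), comp (rho A) (cunit (bang A)) = cunit A
  -- a deriving transformation [d.1]-[d.5]
  der : ∀ (A : Obj), Hom (ten (bang A) A) (bang A)
  der_natural : ∀ {A B : Obj} (f : Hom A B),
    comp (tHom (bangMap f) f) (der B) = comp (der A) (bangMap f)
  -- [d.1] constant rule
  der_cunit : ∀ (A : Obj), comp (der A) (cunit A) = zero
  -- [d.2] Leibniz rule
  der_cmul : ∀ (A : Obj),
    comp (der A) (cmul A) =
      add
        (comp (tHom (cmul A) (id A))
          (comp (toSMCData.cHom (tenAssoc (bang A) (bang A) A))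
            (comp (tHom (id (bang A)) (sw (bang A) A))
              (comp (toSMCData.cHom (tenAssoc (bang A) A (bang A)).symm)
                (tHom (der A) (id (bang A)))))))
        (comp (tHom (cmul A) (id A))
          (comp (toSMCData.cHom (tenAssoc (bang A) (bang A) A))
            (tHom (id (bang A)) (der A))))
  -- [d.3] linear rule
  der_eps : ∀ (A : Obj),
    comp (der A) (eps A) = comp (tHom (cunit A) (id A)) (toSMCData.cHom (unit_ten A))
  -- [d.4] chain rule
  der_rho : ∀ (A : Obj),
    comp (der A) (rho A) =
      comp (tHom (cmul A) (id A))
        (comp (toSMCData.cHom (tenAssoc (bang A) (bang A) A))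
          (comp (tHom (rho A) (der A)) (der (bang A))))
  -- [d.5] interchange rule
  der_interchange : ∀ (A : Obj),
    comp (tHom (der A) (id A)) (der A) =
      comp (toSMCData.cHom (tenAssoc (bang A) A A))
        (comp (tHom (id (bang A)) (sw A A))
          (comp (toSMCData.cHom (tenAssoc (bang A) A A).symm)
            (comp (tHom (der A) (id A)) (der A))))

def DiffCat.cHom (C : DiffCat) {A B : C.Obj} (h : A = B) : C.Hom A B :=
  C.toSMCData.cHom h

namespace DiffCat

variable (C : DiffCat)

/-- The coderiving transformation d°_A := Δ_A (1 ⊗ ε_A). -/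
def dcirc (A : C.Obj) : C.Hom (C.bang A) (C.ten (C.bang A) A) :=
  C.comp (C.cmul A) (C.tHom (C.id (C.bang A)) (C.eps A))

/-- K_A := d°_A d_A + !(0). -/
def K (A : C.Obj) : C.Hom (C.bang A) (C.bang A) :=
  C.add (C.comp (C.dcirc A) (C.der A)) (C.bangMap (C.zero : C.Hom A A))

/-- J_A := d°_A d_A + 1_{!A}. -/
def J (A : C.Obj) : C.Hom (C.bang A) (C.bang A) :=
  C.add (C.comp (C.dcirc A) (C.der A)) (C.id (C.bang A))

/-- The deriving transformation at the monoidal unit, under the strictness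
identification !R ⊗ R = !R. -/
def dR : C.Hom (C.bang C.unit) (C.bang C.unit) :=
  C.comp (C.cHom (C.ten_unit (C.bang C.unit)).symm) (C.der C.unit)

/-- The coderiving transformation at the monoidal unit, under the strictness
identification !R ⊗ R = !R. -/
def dcircR : C.Hom (C.bang C.unit) (C.bang C.unit) :=
  C.comp (C.dcirc C.unit) (C.cHom (C.ten_unit (C.bang C.unit)))

end DiffCat

namespace SMCData

variable (C : SMCData)

theorem cHom_rfl (A : C.Obj) : C.cHom (rfl : A = A) = C.id A := rfl

theorem cHom_trans {A B D : C.Obj} (h : A = B) (k : B = D) :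
    C.comp (C.cHom h) (C.cHom k) = C.cHom (h.trans k) := by
  subst h k
  exact C.id_comp _

theorem tHom_id_cHom (X : C.Obj) {A B : C.Obj} (h : A = B) :
    C.tHom (C.id X) (C.cHom h) = C.cHom (congrArg (C.ten X) h) := by
  subst h
  exact C.tHom_id _ _

theorem tHom_cHom_id (X : C.Obj) {A B : C.Obj} (h : A = B) :
    C.tHom (C.cHom h) (C.id X) = C.cHom (congrArg (fun Y => C.ten Y X) h) := by
  subst h
  exact C.tHom_id _ _

theorem cHom_comp_cHom_symm {A B D : C.Obj} (h : A = B) (f : C.Hom A D) :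
    C.comp (C.cHom h) (C.comp (C.cHom h.symm) f) = f := by
  subst h
  simp only [cHom_rfl, C.id_comp]

theorem eq_comp_cHom_symm {A B D : C.Obj} (h : A = B) {f : C.Hom D B} {g : C.Hom D A}
    (hf : C.comp g (C.cHom h) = f) : C.comp f (C.cHom h.symm) = g := by
  subst h hf
  simp only [cHom_rfl, C.comp_id]

theorem tHom_id_comp (X : C.Obj) {A B D : C.Obj} (f : C.Hom A B) (g : C.Hom B D) :
    C.tHom (C.id X) (C.comp f g) = C.comp (C.tHom (C.id X) f) (C.tHom (C.id X) g) := by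
  rw [← C.tHom_comp, C.id_comp]

theorem tHom_comp_id (X : C.Obj) {A B D : C.Obj} (f : C.Hom A B) (g : C.Hom B D) :
    C.tHom (C.comp f g) (C.id X) = C.comp (C.tHom f (C.id X)) (C.tHom g (C.id X)) := by
  rw [← C.tHom_comp, C.id_comp]

theorem tHom_exchange {A A' B B' : C.Obj} (f : C.Hom A A') (g : C.Hom B B') :
    C.comp (C.tHom f (C.id B)) (C.tHom (C.id A') g) =
      C.comp (C.tHom (C.id A) g) (C.tHom f (C.id B')) := by
  simp only [← C.tHom_comp, C.id_comp, C.comp_id]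

end SMCData

namespace DiffCat

variable (C : DiffCat)

theorem zero_add {A B : C.Obj} (f : C.Hom A B) : C.add C.zero f = f := by
  rw [C.add_comm, C.add_zero]

theorem assoc_symm_natural {A₁ A₂ B₁ B₂ C₁ C₂ : C.Obj} (f : C.Hom A₁ A₂) (g : C.Hom B₁ B₂)
    (h : C.Hom C₁ C₂) :
    C.comp (C.tHom f (C.tHom g h)) (C.toSMCData.cHom (C.tenAssoc A₂ B₂ C₂).symm) =
      C.comp (C.toSMCData.cHom (C.tenAssoc A₁ B₁ C₁).symm) (C.tHom (C.tHom f g) h) := by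
  apply C.eq_comp_cHom_symm (C.tenAssoc A₂ B₂ C₂)
  rw [C.comp_assoc, C.assoc_natural]
  exact C.cHom_comp_cHom_symm (C.tenAssoc A₁ B₁ C₁).symm _

/-- The symmetry `1 ⊗ σ` exchanging the last two factors of `(X ⊗ Y) ⊗ Z`. -/
def swapRight (X Y Z : C.Obj) : C.Hom (C.ten (C.ten X Y) Z) (C.ten (C.ten X Z) Y) :=
  C.comp (C.toSMCData.cHom (C.tenAssoc X Y Z))
    (C.comp (C.tHom (C.id X) (C.sw Y Z)) (C.toSMCData.cHom (C.tenAssoc X Z Y).symm))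

theorem swapRight_natural {X X' Y Y' Z Z' : C.Obj} (f : C.Hom X X') (g : C.Hom Y Y')
    (h : C.Hom Z Z') :
    C.comp (C.tHom (C.tHom f g) h) (C.swapRight X' Y' Z') =
      C.comp (C.swapRight X Y Z) (C.tHom (C.tHom f h) g) := by
  have hsw : C.comp (C.tHom f (C.tHom g h)) (C.tHom (C.id X') (C.sw Y' Z')) =
      C.comp (C.tHom (C.id X) (C.sw Y Z)) (C.tHom f (C.tHom h g)) := by
    rw [← C.tHom_comp, ← C.tHom_comp, C.sw_natural, C.id_comp, C.comp_id]
  simp only [swapRight, C.comp_assoc]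
  rw [← C.assoc_symm_natural, ← C.comp_assoc (C.tHom (C.id X) _), ← hsw,
    ← C.comp_assoc (C.tHom (C.tHom f g) h), C.assoc_natural]
  simp only [C.comp_assoc]

theorem cmul_cunit_right_tensor (X Y : C.Obj) :
    C.comp (C.tHom (C.cmul X) (C.id Y))
      (C.comp (C.toSMCData.cHom (C.tenAssoc (C.bang X) (C.bang X) Y))
        (C.tHom (C.id (C.bang X))
          (C.comp (C.tHom (C.cunit X) (C.id Y)) (C.toSMCData.cHom (C.unit_ten Y))))) =
      C.id (C.ten (C.bang X) Y) := by
  rw [C.tHom_id_comp, ← C.comp_assoc (C.toSMCData.cHom _), ← C.assoc_natural, C.comp_assoc,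
    C.tHom_id_cHom, C.cHom_trans,
    ← C.tHom_cHom_id Y (C.ten_unit (C.bang X)), ← C.tHom_comp_id, ← C.tHom_comp_id,
    C.cmul_counit_right, C.tHom_id]

theorem der_comp_dcirc (A : C.Obj) :
    C.comp (C.der A) (C.dcirc A) =
      C.add
        (C.comp (C.tHom (C.dcirc A) (C.id A))
          (C.comp (C.swapRight (C.bang A) A A) (C.tHom (C.der A) (C.id A))))
        (C.id (C.ten (C.bang A) A)) := by
  have hsecond : C.comp (C.comp (C.tHom (C.cmul A) (C.id A))
      (C.comp (C.toSMCData.cHom (C.tenAssoc (C.bang A) (C.bang A) A))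
        (C.tHom (C.id (C.bang A)) (C.der A)))) (C.tHom (C.id (C.bang A)) (C.eps A)) =
      C.id (C.ten (C.bang A) A) := by
    rw [C.comp_assoc, C.comp_assoc, ← C.tHom_id_comp, C.der_eps, C.cmul_cunit_right_tensor]
  rw [dcirc, ← C.comp_assoc, C.der_cmul, C.add_comp, hsecond, C.tHom_comp_id]
  congr 1
  rw [C.comp_assoc (C.tHom (C.cmul A) _), C.comp_assoc (C.tHom (C.cmul A) _),
    ← C.comp_assoc (C.tHom (C.tHom _ _) _), C.swapRight_natural]
  simp only [swapRight, C.comp_assoc]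
  rw [C.tHom_exchange, C.tHom_id]

theorem dcirc_dcirc_assoc (A : C.Obj) :
    C.comp (C.dcirc A) (C.comp (C.tHom (C.dcirc A) (C.id A))
      (C.toSMCData.cHom (C.tenAssoc (C.bang A) A A))) =
      C.comp (C.cmul A) (C.tHom (C.id (C.bang A))
        (C.comp (C.cmul A) (C.tHom (C.eps A) (C.eps A)))) := by
  have hexch : C.comp (C.tHom (C.id (C.bang A)) (C.eps A)) (C.tHom (C.dcirc A) (C.id A)) =
      C.comp (C.tHom (C.cmul A) (C.id (C.bang A)))
        (C.tHom (C.tHom (C.id (C.bang A)) (C.eps A)) (C.eps A)) := by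
    simp only [← C.tHom_comp, C.id_comp, C.comp_id, dcirc]
  rw [C.tHom_id_comp, ← C.comp_assoc (C.cmul A), ← C.cmul_coassoc,
    ← C.comp_assoc (C.dcirc A)]
  conv_lhs => rw [dcirc, C.comp_assoc (C.cmul A), ← dcirc, hexch]
  simp only [C.comp_assoc]
  rw [C.assoc_natural]

/-- Cocommutativity of the coderiving transformation. -/
theorem dcirc_dcirc_swapRight (A : C.Obj) :
    C.comp (C.dcirc A) (C.comp (C.tHom (C.dcirc A) (C.id A)) (C.swapRight (C.bang A) A A)) =
      C.comp (C.dcirc A) (C.tHom (C.dcirc A) (C.id A)) := by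
  have hcocomm : C.comp (C.comp (C.cmul A) (C.tHom (C.eps A) (C.eps A))) (C.sw A A) =
      C.comp (C.cmul A) (C.tHom (C.eps A) (C.eps A)) := by
    rw [C.comp_assoc, C.sw_natural, ← C.comp_assoc, C.cmul_cocomm]
  have hassoc := C.dcirc_dcirc_assoc A
  have hswap : C.comp (C.comp (C.dcirc A) (C.comp (C.tHom (C.dcirc A) (C.id A))
      (C.toSMCData.cHom (C.tenAssoc (C.bang A) A A)))) (C.tHom (C.id (C.bang A)) (C.sw A A)) =
      C.comp (C.dcirc A) (C.comp (C.tHom (C.dcirc A) (C.id A))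
      (C.toSMCData.cHom (C.tenAssoc (C.bang A) A A))) := by
    rw [hassoc, C.comp_assoc, ← C.tHom_id_comp, hcocomm]
  rw [swapRight]
  have hcancel := C.eq_comp_cHom_symm (C.tenAssoc (C.bang A) A A)
    (C.comp_assoc (C.dcirc A) (C.tHom (C.dcirc A) (C.id A)) _)
  rw [← hswap] at hcancel
  simpa only [C.comp_assoc] using hcancel

theorem swapRight_der_der (A : C.Obj) :
    C.comp (C.swapRight (C.bang A) A A) (C.comp (C.tHom (C.der A) (C.id A)) (C.der A)) =
      C.comp (C.tHom (C.der A) (C.id A)) (C.der A) := by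
  conv_rhs => rw [C.der_interchange]
  simp only [swapRight, C.comp_assoc]

theorem der_bangMap_zero (A B : C.Obj) :
    C.comp (C.der A) (C.bangMap (C.zero : C.Hom A B)) = C.zero := by
  rw [← C.der_natural, C.tHom_zero_right, C.zero_comp]

theorem bangMap_zero_dcirc (A B : C.Obj) :
    C.comp (C.bangMap (C.zero : C.Hom A B)) (C.dcirc B) = C.zero := by
  rw [dcirc, ← C.comp_assoc, C.cmul_natural, C.comp_assoc, ← C.tHom_comp, C.eps_natural,
    C.comp_zero, C.tHom_zero_right, C.comp_zero]

theorem bangMap_zero_bangMap_zero (A : C.Obj) :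
    C.comp (C.bangMap (C.zero : C.Hom A A)) (C.bangMap (C.zero : C.Hom A A)) =
      C.bangMap C.zero := by
  rw [← C.bangMap_comp, C.zero_comp]

theorem K_comp_dcirc (A : C.Obj) :
    C.comp (C.K A) (C.dcirc A) = C.comp (C.dcirc A) (C.tHom (C.J A) (C.id A)) := by
  rw [K, J, C.add_comp, C.bangMap_zero_dcirc, C.add_zero, C.comp_assoc, C.der_comp_dcirc,
    C.tHom_add_left, C.comp_add, C.comp_add, C.tHom_id, C.tHom_comp_id,
    ← C.comp_assoc (C.tHom _ _), ← C.comp_assoc, C.dcirc_dcirc_swapRight, C.comp_assoc]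

theorem der_comp_K (A : C.Obj) :
    C.comp (C.der A) (C.K A) = C.comp (C.tHom (C.J A) (C.id A)) (C.der A) := by
  rw [K, J, C.comp_add, C.der_bangMap_zero, C.add_zero, ← C.comp_assoc, C.der_comp_dcirc,
    C.tHom_add_left, C.add_comp, C.add_comp, C.tHom_id, C.tHom_comp_id]
  simp only [C.comp_assoc]
  rw [C.swapRight_der_der]

end DiffCat

/-- Proposition 4.4 (Cockett–Lemay): identities relating K, J, !(0),
the deriving and coderiving transformations. -/
theorem statement1 (C : DiffCat) (A : C.Obj) :
    (C.comp (C.K A) (C.bangMap (C.zero : C.Hom A A)) = C.bangMap (C.zero : C.Hom A A)) ∧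
    (C.comp (C.bangMap (C.zero : C.Hom A A)) (C.K A) = C.bangMap (C.zero : C.Hom A A)) ∧
    (C.comp (C.J A) (C.bangMap (C.zero : C.Hom A A)) = C.bangMap (C.zero : C.Hom A A)) ∧
    (C.comp (C.bangMap (C.zero : C.Hom A A)) (C.J A) = C.bangMap (C.zero : C.Hom A A)) ∧
    (C.comp (C.K A) (C.dcirc A) = C.comp (C.dcirc A) (C.tHom (C.J A) (C.id A))) ∧
    (C.comp (C.der A) (C.K A) = C.comp (C.tHom (C.J A) (C.id A)) (C.der A)) := by
  refine ⟨?_, ?_, ?_, ?_, C.K_comp_dcirc A, C.der_comp_K A⟩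
  · rw [DiffCat.K, C.add_comp, C.comp_assoc, C.der_bangMap_zero, C.comp_zero, C.zero_add,
      C.bangMap_zero_bangMap_zero]
  · rw [DiffCat.K, C.comp_add, ← C.comp_assoc, C.bangMap_zero_dcirc, C.zero_comp, C.zero_add,
      C.bangMap_zero_bangMap_zero]
  · rw [DiffCat.J, C.add_comp, C.comp_assoc, C.der_bangMap_zero, C.comp_zero, C.zero_add,
      C.id_comp]
  · rw [DiffCat.J, C.comp_add, ← C.comp_assoc, C.bangMap_zero_dcirc, C.zero_comp, C.zero_add,
      C.comp_id]
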